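/- Let n ≥ 3 be an integer, let δ₀ ≥ n be a real constant, and let Ĥ be a nonnegative continuous function on (0,∞). Then for any 0 < ε < R there exists a unique function a ∈ C²([ε,R]) satisfying a''(r) + ((n-1)/r)·a'(r) + (n(n+2)·U(r)^{4/(n-2)} − δ₀/r²)·a(r) = −Ĥ(r) for all r ∈ (ε,R), with boundary conditions a(ε) = a(R) = 0. Moreover this solution satisfies a(r) ≥ 0 for all r ∈ [ε,R]. -/

import Mathlib

open Set

/-- The standard bubble `U(r) = (1 + r²)^{-(n-2)/2}`. -/
noncomputable def U (n : ℕ) (r : ℝ) : ℝ := (1 + r ^ 2) ^ (-(((n : ℝ) - 2) / 2))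

/-- `a` is a `C²` solution of
`a'' + ((n-1)/r) a' + (n(n+2) U^{4/(n-2)} − δ₀/r²) a = −Ĥ` on `(ε, R)`
with zero Dirichlet boundary conditions at `ε` and `R`. -/
def IsSolBVP (n : ℕ) (δ₀ : ℝ) (H : ℝ → ℝ) (ε R : ℝ) (a : ℝ → ℝ) : Prop :=
  ContinuousOn a (Icc ε R) ∧ ContDiffOn ℝ 2 a (Ioo ε R) ∧
  (∀ r ∈ Ioo ε R,
    deriv (deriv a) r + ((n : ℝ) - 1) / r * deriv a r +
      ((n : ℝ) * ((n : ℝ) + 2) * U n r ^ ((4 : ℝ) / ((n : ℝ) - 2)) - δ₀ / r ^ 2) * a r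
      = -H r) ∧
  a ε = 0 ∧ a R = 0

/-- Clamping a real number to `[-M, M]`. -/
noncomputable def clamp (M x : ℝ) : ℝ := max (-M) (min M x)

lemma lipschitzWith_clamp (M : ℝ) : LipschitzWith 1 (clamp M) :=
  (LipschitzWith.id.const_min M).const_max (-M)

lemma abs_clamp_le {M : ℝ} (hM : 0 ≤ M) (x : ℝ) : |clamp M x| ≤ M := by
  unfold clamp
  rw [abs_le]
  exact ⟨le_max_left _ _, max_le (by linarith) (min_le_left _ _)⟩

lemma clamp_of_abs_le {M x : ℝ} (h : |x| ≤ M) : clamp M x = x := by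
  rw [abs_le] at h
  rw [clamp, min_eq_right h.2, max_eq_right h.1]

lemma abs_clamp_le_abs {M : ℝ} (hM : 0 ≤ M) (x : ℝ) : |clamp M x| ≤ |x| := by
  rcases le_total |x| M with h | h
  · rw [clamp_of_abs_le h]
  · exact (abs_clamp_le hM x).trans h

/-- Global existence for the initial value problem of a planar linear system. -/
lemma exists_linear_ivp {a b : ℝ} (hab : a ≤ b) {A : ℝ → (ℝ × ℝ) →L[ℝ] (ℝ × ℝ)}
    {g : ℝ → ℝ × ℝ} (hA : ContinuousOn A (Icc a b)) (hg : ContinuousOn g (Icc a b))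
    (x₀ : ℝ × ℝ) :
    ∃ x : ℝ → ℝ × ℝ, x a = x₀ ∧
      ∀ t ∈ Icc a b, HasDerivWithinAt x (A t (x t) + g t) (Icc a b) t := by
  obtain ⟨K, hK⟩ := isCompact_Icc.exists_bound_of_continuousOn hA
  obtain ⟨C, hC⟩ := isCompact_Icc.exists_bound_of_continuousOn hg
  have ha : a ∈ Icc a b := left_mem_Icc.2 hab
  have hK0 : 0 ≤ K := (norm_nonneg _).trans (hK a ha)
  have hC0 : 0 ≤ C := (norm_nonneg _).trans (hC a ha)
  set M := gronwallBound ‖x₀‖ K C (b - a)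
  have hmono := gronwallBound_mono (norm_nonneg x₀) hC0 hK0
  have hM : 0 ≤ M := by
    have := hmono (sub_nonneg.2 hab)
    rw [gronwallBound_x0] at this
    exact (norm_nonneg _).trans this
  set P : ℝ × ℝ → ℝ × ℝ := fun x => (clamp M x.1, clamp M x.2) with hP
  have hPlip : LipschitzWith 1 P := by
    simpa using ((lipschitzWith_clamp M).comp LipschitzWith.prod_fst).prodMk
      ((lipschitzWith_clamp M).comp LipschitzWith.prod_snd)
  have hPM (x : ℝ × ℝ) : ‖P x‖ ≤ M := by
    simp only [hP, Prod.norm_def, Real.norm_eq_abs]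
    exact max_le (abs_clamp_le hM _) (abs_clamp_le hM _)
  have hPx (x : ℝ × ℝ) : ‖P x‖ ≤ ‖x‖ := by
    simp only [hP, Prod.norm_def, Real.norm_eq_abs]
    exact max_le_max (abs_clamp_le_abs hM _) (abs_clamp_le_abs hM _)
  have hPid (x : ℝ × ℝ) (hx : ‖x‖ ≤ M) : P x = x := by
    simp only [Prod.norm_def, Real.norm_eq_abs, max_le_iff] at hx
    simp only [hP, clamp_of_abs_le hx.1, clamp_of_abs_le hx.2]
  lift K to NNReal using hK0
  set L : NNReal := ⟨K * M + C, by positivity⟩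
  have hPL : IsPicardLindelof (fun t x => A t (P x) + g t) (⟨a, ha⟩ : Icc a b) x₀
      (L * ⟨b - a, sub_nonneg.2 hab⟩) 0 L K :=
    { lipschitzOnWith := by
        intro t ht
        refine LipschitzWith.lipschitzOnWith ?_
        refine LipschitzWith.of_dist_le_mul fun x y => ?_
        rw [dist_add_right, dist_eq_norm, ← map_sub]
        refine ((A t).le_opNorm _).trans ?_
        have h2 := hPlip.dist_le_mul x y
        rw [NNReal.coe_one, one_mul, dist_eq_norm] at h2
        exact mul_le_mul (hK t ht) h2 (norm_nonneg _) K.2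
      continuousOn := fun x _ => (hA.clm_apply continuousOn_const).add hg
      norm_le := by
        intro t ht x _
        refine (norm_add_le _ _).trans (add_le_add ?_ (hC t ht))
        exact ((A t).le_opNorm _).trans
          (mul_le_mul (hK t ht) (hPM x) (norm_nonneg _) K.2)
      mul_max_le := by
        simp only [sub_self, max_eq_left (sub_nonneg.2 hab), NNReal.coe_zero, sub_zero]
        exact le_rfl }
  obtain ⟨x, hxa, hx⟩ := hPL.exists_eq_forall_mem_Icc_hasDerivWithinAt₀
  refine ⟨x, hxa, fun t ht => ?_⟩
  have hxM : ‖x t‖ ≤ M := by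
    have h := norm_le_gronwallBound_of_norm_deriv_right_le (f := x)
      (f' := fun t => A t (P (x t)) + g t) (δ := ‖x₀‖) (K := K) (ε := C) (a := a) (b := b)
      (fun s hs => (hx s hs).continuousWithinAt)
      (fun s hs => (hx s (Ico_subset_Icc_self hs)).mono_of_mem_nhdsWithin
        (Icc_mem_nhdsGE_of_mem hs)) (by exact hxa ▸ le_rfl)
      (fun s hs => (norm_add_le _ _).trans (add_le_add
        (((A s).le_opNorm _).trans (mul_le_mul (hK s (Ico_subset_Icc_self hs)) (hPx _)
          (norm_nonneg _) K.2)) (hC s (Ico_subset_Icc_self hs)))) t ht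
    exact h.trans (hmono (by linarith [ht.2]))
  have := hx t ht
  simpa only [hPid _ hxM] using this

/-- Global existence for the initial value problem of a scalar second order linear equation. -/
lemma exists_second_order_ivp {a b : ℝ} (hab : a ≤ b) {p q h : ℝ → ℝ}
    (hp : ContinuousOn p (Icc a b)) (hq : ContinuousOn q (Icc a b))
    (hh : ContinuousOn h (Icc a b)) (x₀ x₁ : ℝ) :
    ∃ u v : ℝ → ℝ, u a = x₀ ∧ v a = x₁ ∧
      (∀ t ∈ Icc a b, HasDerivWithinAt u (v t) (Icc a b) t) ∧
      ∀ t ∈ Icc a b, HasDerivWithinAt v (h t - p t * v t - q t * u t) (Icc a b) t := by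
  let F := ContinuousLinearMap.fst ℝ ℝ ℝ
  let S := ContinuousLinearMap.snd ℝ ℝ ℝ
  let I := ContinuousLinearMap.inl ℝ ℝ ℝ
  let J := ContinuousLinearMap.inr ℝ ℝ ℝ
  have hA : ContinuousOn (fun t => I ∘L S - p t • (J ∘L S) - q t • (J ∘L F)) (Icc a b) :=
    (continuousOn_const.sub (hp.smul continuousOn_const)).sub (hq.smul continuousOn_const)
  have hg : ContinuousOn (fun t => ((0 : ℝ), h t)) (Icc a b) := continuousOn_const.prodMk hh
  obtain ⟨x, hx0, hx⟩ := exists_linear_ivp hab hA hg (x₀, x₁)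
  refine ⟨fun t => (x t).1, fun t => (x t).2, by simp [hx0], by simp [hx0],
    fun t ht => ?_, fun t ht => ?_⟩
  · have := (F.hasFDerivAt (x := x t)).comp_hasDerivWithinAt t (hx t ht)
    refine this.congr_deriv ?_
    simp [F, S, I, J]
  · have := (S.hasFDerivAt (x := x t)).comp_hasDerivWithinAt t (hx t ht)
    refine this.congr_deriv ?_
    simp [F, S, I, J]
    ring

/-- Maximum principle: if `u'' + p u' + q u` has a positive strict supersolution `φ`, then every
supersolution that is nonnegative at the endpoints is nonnegative. -/
lemma nonneg_of_supersolution {a b : ℝ} {p q φ u : ℝ → ℝ}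
    (hφc : ContinuousOn φ (Icc a b)) (hφpos : ∀ t ∈ Icc a b, 0 < φ t)
    (hφ1 : ∀ t ∈ Ioo a b, DifferentiableAt ℝ φ t)
    (hφ2 : ∀ t ∈ Ioo a b, DifferentiableAt ℝ (deriv φ) t)
    (hφ : ∀ t ∈ Ioo a b, deriv (deriv φ) t + p t * deriv φ t + q t * φ t < 0)
    (huc : ContinuousOn u (Icc a b))
    (hu1 : ∀ t ∈ Ioo a b, DifferentiableAt ℝ u t)
    (hu2 : ∀ t ∈ Ioo a b, DifferentiableAt ℝ (deriv u) t)
    (hu : ∀ t ∈ Ioo a b, deriv (deriv u) t + p t * deriv u t + q t * u t ≤ 0)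
    (hua : 0 ≤ u a) (hub : 0 ≤ u b) : ∀ t ∈ Icc a b, 0 ≤ u t := by
  intro t ht
  obtain ⟨s, hs, hmin⟩ := isCompact_Icc.exists_isMinOn ⟨t, ht⟩
    (huc.div hφc fun t ht => (hφpos t ht).ne')
  rw [isMinOn_iff] at hmin
  simp only [Pi.div_apply] at hmin
  set k := u s / φ s with hk
  by_contra! hneg
  have hk0 : k < 0 := (hmin t ht).trans_lt (div_neg_of_neg_of_pos hneg (hφpos t ht))
  have hus : u s = k * φ s := by rw [hk, div_mul_cancel₀ _ (hφpos s hs).ne']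
  have hus0 : u s < 0 := hus ▸ mul_neg_of_neg_of_pos hk0 (hφpos s hs)
  have hsI : s ∈ Ioo a b := by
    refine ⟨lt_of_le_of_ne hs.1 ?_, lt_of_le_of_ne hs.2 ?_⟩
    · rintro rfl; linarith
    · rintro rfl; linarith
  have hnhds : Ioo a b ∈ nhds s := Ioo_mem_nhds hsI.1 hsI.2
  set g : ℝ → ℝ := fun t => u t - k * φ t with hg
  have hgs : g s = 0 := by simp [hg, hus]
  have hlmin : IsLocalMin g s := by
    filter_upwards [hnhds] with r hr
    have hr' := Ioo_subset_Icc_self hr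
    have := hmin r hr'
    rw [le_div_iff₀ (hφpos r hr')] at this
    rw [hgs]
    exact sub_nonneg.2 this
  have hd1 (r : ℝ) (hr : r ∈ Ioo a b) : HasDerivAt g (deriv u r - k * deriv φ r) r :=
    (hu1 r hr).hasDerivAt.sub ((hφ1 r hr).hasDerivAt.const_mul k)
  have hd1' : deriv g =ᶠ[nhds s] fun r => deriv u r - k * deriv φ r := by
    filter_upwards [hnhds] with r hr using (hd1 r hr).deriv
  have hd2 : deriv (deriv g) s = deriv (deriv u) s - k * deriv (deriv φ) s := by
    rw [hd1'.deriv_eq]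
    exact ((hu2 s hsI).hasDerivAt.sub ((hφ2 s hsI).hasDerivAt.const_mul k)).deriv
  have hg0 : deriv g s = 0 := hlmin.deriv_eq_zero
  have hu's : deriv u s = k * deriv φ s := by
    rw [(hd1 s hsI).deriv] at hg0
    linarith
  have hlt : deriv (deriv g) s < 0 := by
    have h1 := hu s hsI
    have h2 := mul_pos_of_neg_of_neg hk0 (hφ s hsI)
    rw [hu's, hus] at h1
    rw [hd2]
    linarith
  have hlmax := isLocalMax_of_deriv_deriv_neg hlt hg0 (hd1 s hsI).continuousAt
  have hconst : g =ᶠ[nhds s] fun _ => g s := by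
    filter_upwards [hlmin, hlmax] with r h1 h2 using le_antisymm h2 h1
  have hzero : deriv (deriv g) s = 0 := by
    rw [hconst.deriv.deriv_eq]
    simp
  exact hlt.ne hzero

/-- A function with the derivatives `v` and `w` on `[a, b]`, where `w` is continuous, is `C²` in
the interior, with the expected derivatives. -/
lemma contDiffOn_two_of_hasDerivWithinAt {a b : ℝ} {u v w : ℝ → ℝ}
    (hu : ∀ t ∈ Icc a b, HasDerivWithinAt u (v t) (Icc a b) t)
    (hv : ∀ t ∈ Icc a b, HasDerivWithinAt v (w t) (Icc a b) t)
    (hw : ContinuousOn w (Icc a b)) :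
    ContDiffOn ℝ 2 u (Ioo a b) ∧ (∀ t ∈ Ioo a b, deriv u t = v t) ∧
      ∀ t ∈ Ioo a b, deriv (deriv u) t = w t := by
  have hu' (t) (ht : t ∈ Ioo a b) : HasDerivAt u (v t) t :=
    (hu t (Ioo_subset_Icc_self ht)).hasDerivAt (Icc_mem_nhds ht.1 ht.2)
  have hv' (t) (ht : t ∈ Ioo a b) : HasDerivAt v (w t) t :=
    (hv t (Ioo_subset_Icc_self ht)).hasDerivAt (Icc_mem_nhds ht.1 ht.2)
  have h1 : EqOn (deriv u) v (Ioo a b) := fun t ht => (hu' t ht).deriv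
  have h2 : EqOn (deriv v) w (Ioo a b) := fun t ht => (hv' t ht).deriv
  refine ⟨?_, h1, fun t ht => ?_⟩
  · rw [show (2 : WithTop ℕ∞) = 1 + 1 by norm_num,
      contDiffOn_succ_iff_deriv_of_isOpen isOpen_Ioo]
    refine ⟨fun t ht => (hu' t ht).differentiableAt.differentiableWithinAt, by simp, ?_⟩
    rw [contDiffOn_congr h1, show (1 : WithTop ℕ∞) = 0 + 1 by norm_num,
      contDiffOn_succ_iff_deriv_of_isOpen isOpen_Ioo]
    refine ⟨fun t ht => (hv' t ht).differentiableAt.differentiableWithinAt, by simp, ?_⟩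
    rw [contDiffOn_congr h2, contDiffOn_zero]
    exact hw.mono Ioo_subset_Icc_self
  · rw [(h1.eventuallyEq_of_mem (Ioo_mem_nhds ht.1 ht.2)).deriv_eq, h2 ht]

lemma differentiableAt_and_deriv_of_contDiffOn_two {s : Set ℝ} (hs : IsOpen s) {u : ℝ → ℝ}
    (hu : ContDiffOn ℝ 2 u s) :
    (∀ t ∈ s, DifferentiableAt ℝ u t) ∧ ∀ t ∈ s, DifferentiableAt ℝ (deriv u) t := by
  rw [show (2 : WithTop ℕ∞) = 1 + 1 by norm_num,
    contDiffOn_succ_iff_deriv_of_isOpen hs] at hu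
  exact ⟨fun t ht => (hu.1 t ht).differentiableAt (hs.mem_nhds ht),
    fun t ht => (hu.2.2.differentiableOn (by norm_num) t ht).differentiableAt (hs.mem_nhds ht)⟩

/-- The Dirichlet problem for `u'' + p u' + q u = h` is solvable when the operator has a positive
strict supersolution. -/
lemma exists_dirichlet {a b : ℝ} (hab : a < b) {p q h φ : ℝ → ℝ}
    (hp : ContinuousOn p (Icc a b)) (hq : ContinuousOn q (Icc a b))
    (hh : ContinuousOn h (Icc a b))
    (hφc : ContinuousOn φ (Icc a b)) (hφpos : ∀ t ∈ Icc a b, 0 < φ t)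
    (hφ1 : ∀ t ∈ Ioo a b, DifferentiableAt ℝ φ t)
    (hφ2 : ∀ t ∈ Ioo a b, DifferentiableAt ℝ (deriv φ) t)
    (hφ : ∀ t ∈ Ioo a b, deriv (deriv φ) t + p t * deriv φ t + q t * φ t < 0) :
    ∃ u : ℝ → ℝ, ContinuousOn u (Icc a b) ∧ ContDiffOn ℝ 2 u (Ioo a b) ∧
      (∀ t ∈ Ioo a b, deriv (deriv u) t + p t * deriv u t + q t * u t = h t) ∧
      u a = 0 ∧ u b = 0 := by
  obtain ⟨u₀, v₀, hu₀a, -, hu₀, hv₀⟩ := exists_second_order_ivp hab.le hp hq hh 0 0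
  obtain ⟨u₁, v₁, hu₁a, hv₁a, hu₁, hv₁⟩ :=
    exists_second_order_ivp hab.le hp hq (continuousOn_const (c := (0 : ℝ))) 0 1
  have cont {f f' : ℝ → ℝ} (hf : ∀ t ∈ Icc a b, HasDerivWithinAt f (f' t) (Icc a b) t) :
      ContinuousOn f (Icc a b) := fun t ht => (hf t ht).continuousWithinAt
  have hu₁b : u₁ b ≠ 0 := by
    intro hu₁b
    obtain ⟨hC, hd, hdd⟩ := contDiffOn_two_of_hasDerivWithinAt hu₁ hv₁
      ((continuousOn_const.sub (hp.mul (cont hv₁))).sub (hq.mul (cont hu₁)))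
    obtain ⟨hD, hDD⟩ := differentiableAt_and_deriv_of_contDiffOn_two isOpen_Ioo hC
    have hpos := nonneg_of_supersolution hφc hφpos hφ1 hφ2 hφ (cont hu₁) hD hDD
      (fun t ht => by rw [hdd t ht, hd t ht]; linarith) hu₁a.ge hu₁b.ge
    have hneg := nonneg_of_supersolution (u := -u₁) hφc hφpos hφ1 hφ2 hφ (cont hu₁).neg
      (fun t ht => (hD t ht).neg) (fun t ht => by rw [deriv.neg']; exact (hDD t ht).neg)
      (fun t ht => by
        rw [deriv.neg', deriv.fun_neg, Pi.neg_apply, hdd t ht]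
        beta_reduce
        rw [hd t ht]
        linarith)
      (by simp [hu₁a]) (by simp [hu₁b])
    have ha : a ∈ Icc a b := left_mem_Icc.2 hab.le
    have hz : HasDerivWithinAt u₁ 0 (Icc a b) a :=
      (hasDerivWithinAt_const a (Icc a b) (0 : ℝ)).congr_of_mem
        (fun t ht => le_antisymm (neg_nonneg.1 (hneg t ht)) (hpos t ht)) ha
    have := (uniqueDiffOn_Icc hab a ha).eq_deriv _ (hu₁ a ha) hz
    rw [hv₁a] at this
    exact one_ne_zero this
  set k := u₀ b / u₁ b with hk
  have hu (t) (ht : t ∈ Icc a b) :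
      HasDerivWithinAt (fun t => u₀ t - k * u₁ t) (v₀ t - k * v₁ t) (Icc a b) t :=
    (hu₀ t ht).sub ((hu₁ t ht).const_mul k)
  have hv (t) (ht : t ∈ Icc a b) := (hv₀ t ht).sub ((hv₁ t ht).const_mul k)
  obtain ⟨hC, hd, hdd⟩ := contDiffOn_two_of_hasDerivWithinAt hu hv
    (((hh.sub (hp.mul (cont hv₀))).sub (hq.mul (cont hu₀))).sub
      (continuousOn_const.mul
        ((continuousOn_const.sub (hp.mul (cont hv₁))).sub (hq.mul (cont hu₁)))))
  refine ⟨_, cont hu, hC, fun t ht => ?_, by simp [hu₀a, hu₁a], ?_⟩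
  · rw [hdd t ht, hd t ht]; ring
  · simp [hk, hu₁b]

lemma U_rpow {n : ℕ} (hn : 3 ≤ n) (r : ℝ) :
    U n r ^ ((4 : ℝ) / ((n : ℝ) - 2)) = 1 / (1 + r ^ 2) ^ 2 := by
  have h1 : (0 : ℝ) < 1 + r ^ 2 := by positivity
  have hn' : (3 : ℝ) ≤ n := by exact_mod_cast hn
  have h2 : (n : ℝ) - 2 ≠ 0 := by linarith
  rw [U, ← Real.rpow_mul h1.le,
    show -(((n : ℝ) - 2) / 2) * (4 / ((n : ℝ) - 2)) = -((2 : ℕ) : ℝ) by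
      push_cast; field_simp; norm_num,
    Real.rpow_neg h1.le, Real.rpow_natCast, one_div]

/-- A positive multiple of `-U'`. -/
noncomputable def bubbleDeriv (n : ℕ) (r : ℝ) : ℝ := r * (1 + r ^ 2) ^ (-((n : ℝ) / 2))

lemma hasDerivAt_one_add_sq_rpow (n : ℕ) (r : ℝ) :
    HasDerivAt (fun r : ℝ => (1 + r ^ 2) ^ (-((n : ℝ) / 2)))
      (-(n * r * (1 + r ^ 2) ^ (-((n : ℝ) / 2)) / (1 + r ^ 2))) r := by
  have h1 : (0 : ℝ) < 1 + r ^ 2 := by positivity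
  refine (((hasDerivAt_pow 2 r).const_add 1).rpow_const (p := -((n : ℝ) / 2))
    (Or.inl h1.ne')).congr_deriv ?_
  rw [Real.rpow_sub_one h1.ne']
  push_cast
  ring

lemma hasDerivAt_bubbleDeriv (n : ℕ) (r : ℝ) :
    HasDerivAt (bubbleDeriv n)
      ((1 - n * r ^ 2 / (1 + r ^ 2)) * (1 + r ^ 2) ^ (-((n : ℝ) / 2))) r := by
  refine ((hasDerivAt_id r).mul (hasDerivAt_one_add_sq_rpow n r)).congr_deriv ?_
  simp only [id]
  ring

lemma hasDerivAt_deriv_bubbleDeriv (n : ℕ) (r : ℝ) :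
    HasDerivAt (deriv (bubbleDeriv n))
      ((-(2 * n * r / (1 + r ^ 2) ^ 2) - (1 - n * r ^ 2 / (1 + r ^ 2)) * (n * r / (1 + r ^ 2)))
        * (1 + r ^ 2) ^ (-((n : ℝ) / 2))) r := by
  have h1 : (1 : ℝ) + r ^ 2 ≠ 0 := by positivity
  rw [show deriv (bubbleDeriv n) = _ from funext fun r => (hasDerivAt_bubbleDeriv n r).deriv]
  have h2 := (((hasDerivAt_pow 2 r).const_mul (n : ℝ)).div
    ((hasDerivAt_pow 2 r).const_add 1) h1).const_sub 1
  refine (h2.mul (hasDerivAt_one_add_sq_rpow n r)).congr_deriv ?_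
  simp only [Pi.div_apply]
  field_simp
  push_cast
  ring

/-- `bubbleDeriv n` solves the equation linearized at the bubble, in the first spherical mode. -/
lemma bubbleDeriv_equation (n : ℕ) {r : ℝ} (hr : r ≠ 0) :
    deriv (deriv (bubbleDeriv n)) r + ((n : ℝ) - 1) / r * deriv (bubbleDeriv n) r +
      ((n : ℝ) * (n + 2) * (1 / (1 + r ^ 2) ^ 2) - (n - 1) / r ^ 2) * bubbleDeriv n r = 0 := by
  have h1 : (1 : ℝ) + r ^ 2 ≠ 0 := by positivity
  rw [(hasDerivAt_deriv_bubbleDeriv n r).deriv, (hasDerivAt_bubbleDeriv n r).deriv, bubbleDeriv]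
  field_simp
  ring

lemma bubbleDeriv_pos (n : ℕ) {r : ℝ} (hr : 0 < r) : 0 < bubbleDeriv n r := by
  unfold bubbleDeriv
  positivity

/-- for `n ≥ 3`, `δ₀ ≥ n` and `Ĥ ≥ 0` continuous on `(0,∞)`,
for any `0 < ε < R` there is a unique `C²` solution of the Dirichlet problem,
and this solution is nonnegative on `[ε, R]`. -/
theorem statement0 (n : ℕ) (hn : 3 ≤ n) (δ₀ : ℝ) (hδ₀ : (n : ℝ) ≤ δ₀)
    (H : ℝ → ℝ) (Hcont : ContinuousOn H (Ioi 0)) (Hnonneg : ∀ r ∈ Ioi (0 : ℝ), 0 ≤ H r)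
    (ε R : ℝ) (hε : 0 < ε) (hεR : ε < R) :
    ∃ a : ℝ → ℝ, IsSolBVP n δ₀ H ε R a ∧
      (∀ b : ℝ → ℝ, IsSolBVP n δ₀ H ε R b → EqOn b a (Icc ε R)) ∧
      ∀ r ∈ Icc ε R, 0 ≤ a r := by
  set p : ℝ → ℝ := fun r => ((n : ℝ) - 1) / r with hp
  set q : ℝ → ℝ := fun r =>
    (n : ℝ) * ((n : ℝ) + 2) * U n r ^ ((4 : ℝ) / ((n : ℝ) - 2)) - δ₀ / r ^ 2 with hq
  have hpos (r) (hr : r ∈ Icc ε R) : 0 < r := hε.trans_le hr.1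
  have hpc : ContinuousOn p (Icc ε R) :=
    continuousOn_const.div continuousOn_id fun r hr => (hpos r hr).ne'
  have hqc : ContinuousOn q (Icc ε R) := by
    simp only [hq, U_rpow hn]
    refine ContinuousOn.sub (continuousOn_const.mul (Continuous.continuousOn ?_))
      (continuousOn_const.div (by fun_prop) fun r hr => (pow_pos (hpos r hr) 2).ne')
    exact continuous_const.div (by fun_prop) fun r => by positivity
  have hφ1 (r : ℝ) : DifferentiableAt ℝ (bubbleDeriv n) r :=
    (hasDerivAt_bubbleDeriv n r).differentiableAt
  have hφ2 (r : ℝ) : DifferentiableAt ℝ (deriv (bubbleDeriv n)) r :=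
    (hasDerivAt_deriv_bubbleDeriv n r).differentiableAt
  have hφc : ContinuousOn (bubbleDeriv n) (Icc ε R) :=
    fun r _ => (hφ1 r).continuousAt.continuousWithinAt
  have hφpos (r) (hr : r ∈ Icc ε R) := bubbleDeriv_pos n (hpos r hr)
  have hφ (r) (hr : r ∈ Ioo ε R) : deriv (deriv (bubbleDeriv n)) r
      + p r * deriv (bubbleDeriv n) r + q r * bubbleDeriv n r < 0 := by
    have hr0 : 0 < r := hpos r (Ioo_subset_Icc_self hr)
    have h1 := bubbleDeriv_equation n hr0.ne'
    have h2 : 0 < (δ₀ - (n - 1)) / r ^ 2 * bubbleDeriv n r :=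
      mul_pos (div_pos (by linarith) (by positivity)) (bubbleDeriv_pos n hr0)
    simp only [hp, hq, U_rpow hn]
    rw [sub_div, sub_mul] at h2
    rw [sub_mul] at h1 ⊢
    linarith
  have hmax {u : ℝ → ℝ} (huc : ContinuousOn u (Icc ε R)) (hu2 : ContDiffOn ℝ 2 u (Ioo ε R))
      (hu : ∀ r ∈ Ioo ε R, deriv (deriv u) r + p r * deriv u r + q r * u r ≤ 0)
      (hua : u ε = 0) (hub : u R = 0) : ∀ r ∈ Icc ε R, 0 ≤ u r := by
    obtain ⟨hD, hDD⟩ := differentiableAt_and_deriv_of_contDiffOn_two isOpen_Ioo hu2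
    exact nonneg_of_supersolution hφc hφpos (fun r _ => hφ1 r) (fun r _ => hφ2 r) hφ huc hD hDD
      hu hua.ge hub.ge
  have hcomp {u w : ℝ → ℝ} (hu : IsSolBVP n δ₀ H ε R u) (hw : IsSolBVP n δ₀ H ε R w) :
      ∀ r ∈ Icc ε R, w r ≤ u r := by
    obtain ⟨huc, hu2, hue, hua, hub⟩ := hu
    obtain ⟨hwc, hw2, hwe, hwa, hwb⟩ := hw
    obtain ⟨hD, hDD⟩ := differentiableAt_and_deriv_of_contDiffOn_two isOpen_Ioo hu2
    obtain ⟨hE, hEE⟩ := differentiableAt_and_deriv_of_contDiffOn_two isOpen_Ioo hw2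
    have hd : EqOn (deriv (u - w)) (deriv u - deriv w) (Ioo ε R) :=
      fun r hr => deriv_sub (hD r hr) (hE r hr)
    refine fun r hr => sub_nonneg.1 (hmax (huc.sub hwc) (hu2.sub hw2) (fun r hr => ?_)
      (by simp [hua, hwa]) (by simp [hub, hwb]) r hr)
    have h1 := hue r hr
    have h2 := hwe r hr
    change deriv (deriv (u - w)) r + p r * deriv (u - w) r + q r * (u r - w r) ≤ 0
    rw [(hd.eventuallyEq_of_mem (Ioo_mem_nhds hr.1 hr.2)).deriv_eq, hd hr,
      deriv_sub (hDD r hr) (hEE r hr), Pi.sub_apply]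
    change _ + p r * _ + q r * _ = _ at h1
    change _ + p r * _ + q r * _ = _ at h2
    linarith
  obtain ⟨u, huc, hu2, hue, hua, hub⟩ := exists_dirichlet hεR hpc hqc
    (Hcont.mono fun r hr => hpos r hr).neg hφc hφpos (fun r _ => hφ1 r) (fun r _ => hφ2 r) hφ
  have hsol : IsSolBVP n δ₀ H ε R u := ⟨huc, hu2, hue, hua, hub⟩
  refine ⟨u, hsol, fun w hw r hr => le_antisymm (hcomp hsol hw r hr) (hcomp hw hsol r hr),
    hmax huc hu2 (fun r hr => ?_) hua hub⟩
  rw [hue r hr]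
  exact neg_nonpos.2 (Hnonneg r (hpos r (Ioo_subset_Icc_self hr)))
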